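/- Let P be a partially shifted head-cycle-free propositional ASP program and ⟨I, δ⟩ a model of Tr(P). Then I ∩ A_P is a model of P, i.e., I ∩ A_P ⊨ P. -/

import Mathlib

/-!
Common framework: propositional ASP programs (disjunctive/choice heads,
normal/weighted bodies), FLP answer sets, dependency graph and SCCs,
(modular) ranked (scc-)supported models, and the asp-fzn translation `Tr(P)`.
-/

namespace AspFzn

open scoped Classical

/-- A rule `H(r) ← B(r)`.  The head is the finite set `headAtoms`, read as a
choice head if `isChoice = true` and as a disjunctive head otherwise
(a constraint rule when moreover `headAtoms = ∅`).  The body is given by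
`bodyPos` (positive literals) and `bodyNeg` (negated literals); it is a
weighted body with lower bound `lb` and weights `wPos`/`wNeg` when
`isWeighted = true`, and a normal body otherwise. -/
structure Rule (α : Type) where
  headAtoms : Finset α
  isChoice : Bool
  bodyPos : Finset α
  bodyNeg : Finset α
  isWeighted : Bool
  wPos : α → ℤ
  wNeg : α → ℤ
  lb : ℤ

/-- A propositional ASP program: a finite list of rules over the finite
set `atoms` (= `A_P`) of propositional atoms. -/
structure Program (α : Type) where
  rules : List (Rule α)
  atoms : Finset α
  wf : ∀ r ∈ rules, r.headAtoms ⊆ atoms ∧ r.bodyPos ⊆ atoms ∧ r.bodyNeg ⊆ atoms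

variable {α : Type} [DecidableEq α]

/-- `r` is a constraint rule: a disjunctive rule with empty head. -/
def Rule.isConstraintRule (r : Rule α) : Prop :=
  r.isChoice = false ∧ r.headAtoms = ∅

/-- Satisfaction of a normal body by interpretation `I`. -/
def normalBodySat (I : Finset α) (r : Rule α) : Prop :=
  r.bodyPos ⊆ I ∧ ∀ b ∈ r.bodyNeg, b ∉ I

/-- Value `Σ_{b ∈ B⁺(r) ∩ I} w_b^r + Σ_{b ∈ B⁻(r) \ I} w_b^r` of a weighted body. -/
def weightedVal (I : Finset α) (r : Rule α) : ℤ :=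
  (∑ b ∈ r.bodyPos.filter (· ∈ I), r.wPos b) +
  (∑ b ∈ r.bodyNeg.filter (· ∉ I), r.wNeg b)

/-- `I ⊨ B(r)`. -/
def bodySat (I : Finset α) (r : Rule α) : Prop :=
  if r.isWeighted then r.lb ≤ weightedVal I r else normalBodySat I r

/-- `I ⊨ H(r)`: every choice head is satisfied; a disjunctive head needs a true disjunct. -/
def headSat (I : Finset α) (r : Rule α) : Prop :=
  r.isChoice = true ∨ ∃ a ∈ r.headAtoms, a ∈ I

/-- `I ⊨ r`. -/
def ruleSat (I : Finset α) (r : Rule α) : Prop :=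
  bodySat I r → headSat I r

/-- `I ⊨ P`. -/
def progSat (I : Finset α) (P : Program α) : Prop :=
  ∀ r ∈ P.rules, ruleSat I r

/-- `J` satisfies the FLP reduct `P^I`. -/
def reductSat (P : Program α) (I J : Finset α) : Prop :=
  ∀ r ∈ P.rules, bodySat I r →
    if r.isChoice then
      ∀ a ∈ r.headAtoms, a ∈ I →
        ((if r.isWeighted then
            max 0 (r.lb - ∑ b ∈ r.bodyNeg.filter (· ∉ I), r.wNeg b)
              ≤ ∑ b ∈ r.bodyPos.filter (· ∈ J), r.wPos b
          else r.bodyPos ⊆ J) → a ∈ J)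
    else
      (bodySat J r → ∃ a ∈ r.headAtoms, a ∈ J)

/-- `I ∈ AS(P)`: `I` is a ⊆-minimal model of the FLP reduct `P^I`. -/
def isAnswerSet (P : Program α) (I : Finset α) : Prop :=
  I ⊆ P.atoms ∧ reductSat P I I ∧ ∀ J ⊆ I, reductSat P I J → J = I

/-- Edge `(a, b)` of the positive dependency graph `DG⁺_P`. -/
def edge (P : Program α) (a b : α) : Prop :=
  ∃ r ∈ P.rules, a ∈ r.headAtoms ∧ b ∈ r.bodyPos

/-- `a` and `b` lie in the same strongly connected component of `DG⁺_P`. -/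
def sameSCC (P : Program α) (a b : α) : Prop :=
  Relation.ReflTransGen (edge P) a b ∧ Relation.ReflTransGen (edge P) b a

/-- `SCC_P(a)`, as a finite subset of `A_P`. -/
noncomputable def scc (P : Program α) (a : α) : Finset α :=
  P.atoms.filter (fun b => sameSCC P a b)

/-- `P` is head-cycle free. -/
def isHCF (P : Program α) : Prop :=
  ∀ r ∈ P.rules, ∀ a ∈ r.headAtoms, ∀ b ∈ r.headAtoms, a ≠ b → b ∉ scc P a

/-- `r` is partially shifted (w.r.t. program `P`). -/
def Rule.partiallyShifted (r : Rule α) (P : Program α) : Prop :=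
  r.isWeighted = false ∨ r.headAtoms.card ≤ 1 ∨
    ∀ a ∈ r.bodyPos, ∀ h ∈ r.headAtoms, h ∉ scc P a

/-- `P` is partially shifted. -/
def isPartiallyShifted (P : Program α) : Prop :=
  ∀ r ∈ P.rules, r.partiallyShifted P

/-- `P` has no tautological rules, i.e. `DG⁺_P` has no self-loops. -/
def noSelfLoops (P : Program α) : Prop :=
  ∀ a, ¬ edge P a a

/-! ### Ranked interpretations and (scc-)support -/

/-- `⟨I, δ⟩` is a ranked interpretation: `δ(ℓ_a) = ∞` iff `a ∉ I`. -/
def isRanked (P : Program α) (I : Finset α) (δ : α → WithTop ℤ) : Prop :=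
  ∀ a ∈ P.atoms, (δ a = ⊤ ↔ a ∉ I)

/-- `Σ_{b ∈ B⁺(r), δ(ℓ_b) < δ(ℓ_a)} w_b^r + Σ_{b ∈ B⁻(r) \ I} w_b^r`. -/
noncomputable def supWeight (I : Finset α) (δ : α → WithTop ℤ) (r : Rule α) (a : α) : ℤ :=
  (∑ b ∈ r.bodyPos.filter (fun b => δ b < δ a), r.wPos b) +
  (∑ b ∈ r.bodyNeg.filter (· ∉ I), r.wNeg b)

/-- Rule `r` supports atom `a ∈ I` in the ranked interpretation `⟨I, δ⟩`. -/
def supports (I : Finset α) (δ : α → WithTop ℤ) (r : Rule α) (a : α) : Prop :=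
  a ∈ r.headAtoms ∧
  (r.isChoice = false → r.headAtoms ∩ I = {a}) ∧
  (if r.isWeighted then r.lb ≤ supWeight I δ r a
   else (∀ b ∈ r.bodyPos, δ b < δ a) ∧ ∀ b ∈ r.bodyNeg, b ∉ I)

/-- `⟨I, δ⟩` is a ranked supported model of `P`. -/
def isRankedSupportedModel (P : Program α) (I : Finset α) (δ : α → WithTop ℤ) : Prop :=
  I ⊆ P.atoms ∧ isRanked P I δ ∧ progSat I P ∧
  ∀ a ∈ I, ∃ r ∈ P.rules, supports I δ r a

/-- `Σ_{b ∈ (B⁺(r) ∩ I) \ SCC_P(a)} w_b^r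
   + Σ_{b ∈ B⁺(r) ∩ SCC_P(a), δ(ℓ_b) < δ(ℓ_a)} w_b^r
   + Σ_{b ∈ B⁻(r) \ I} w_b^r`. -/
noncomputable def sccSupWeight (P : Program α) (I : Finset α) (δ : α → WithTop ℤ)
    (r : Rule α) (a : α) : ℤ :=
  (∑ b ∈ (r.bodyPos.filter (· ∈ I)).filter (fun b => b ∉ scc P a), r.wPos b) +
  (∑ b ∈ (r.bodyPos.filter (fun b => b ∈ scc P a)).filter (fun b => δ b < δ a), r.wPos b) +
  (∑ b ∈ r.bodyNeg.filter (· ∉ I), r.wNeg b)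

/-- Rule `r` scc-supports atom `a ∈ I` in the ranked interpretation `⟨I, δ⟩`. -/
def sccSupports (P : Program α) (I : Finset α) (δ : α → WithTop ℤ)
    (r : Rule α) (a : α) : Prop :=
  a ∈ r.headAtoms ∧
  (r.isChoice = false → r.headAtoms ∩ I = {a}) ∧
  (if r.isWeighted then r.lb ≤ sccSupWeight P I δ r a
   else (∀ b ∈ r.bodyPos, b ∈ I) ∧ (∀ b ∈ r.bodyPos, b ∈ scc P a → δ b < δ a) ∧
        ∀ b ∈ r.bodyNeg, b ∉ I)

/-- `⟨I, δ⟩` is modular: `δ(ℓ_a) ≤ |SCC_P(a)|` for every `a ∈ I`. -/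
def isModular (P : Program α) (I : Finset α) (δ : α → WithTop ℤ) : Prop :=
  ∀ a ∈ I, δ a ≤ (((scc P a).card : ℤ) : WithTop ℤ)

/-- `⟨I, δ⟩` is a modular ranked scc-supported model of `P`. -/
def isModularRankedSccSupportedModel (P : Program α) (I : Finset α)
    (δ : α → WithTop ℤ) : Prop :=
  I ⊆ P.atoms ∧ isRanked P I δ ∧ isModular P I δ ∧ progSat I P ∧
  ∀ a ∈ I, ∃ r ∈ P.rules, sccSupports P I δ r a

/-! ### The translation `Tr(P)` -/

/-- The Boolean variables of the translation.  Rules are identified by their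
index in `P.rules`. -/
inductive TrVar (α : Type) where
  | atom : α → TrVar α            -- one Boolean variable per atom of `A_P`
  | dep : α → α → TrVar α         -- `dep_{a,b}`
  | yv : α → α → TrVar α          -- `y_{a,b}`
  | gap : α → α → TrVar α         -- `gap_{a,b}`
  | bd : ℕ → TrVar α              -- `bd_r`
  | bda : ℕ → α → TrVar α         -- `bd_r^a`
  | sp : ℕ → α → TrVar α          -- `sp_r^a`
  | ext : ℕ → α → TrVar α         -- `ext_r^a`
  | intv : ℕ → α → TrVar α        -- `int_r^a`
  | auxv : ℕ → α → TrVar α        -- `aux_r^a`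

/-- 0-1 value of a Boolean variable in a linear sum. -/
noncomputable def b01 (p : Prop) : ℤ := if p then 1 else 0

/-- `s_a = |SCC_P(a)| + 1`. -/
noncomputable def sVal (P : Program α) (a : α) : ℤ := ((scc P a).card : ℤ) + 1

/-- The locally tight head atoms `T = {a ∈ H(r) : SCC_P(a) ∩ B⁺(r) = ∅}`. -/
noncomputable def tightHeads (P : Program α) (r : Rule α) : Finset α :=
  r.headAtoms.filter (fun a => ∀ b ∈ r.bodyPos, b ∉ scc P a)

/-- `Σ_{b ∈ S} b · w_b` (a true Boolean atom variable counts as 1). -/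
noncomputable def wSumPosV (V : Set (TrVar α)) (S : Finset α) (w : α → ℤ) : ℤ :=
  ∑ b ∈ S.filter (fun b => TrVar.atom b ∈ V), w b

/-- `Σ_{b ∈ S} (¬b) · w_b` (a false Boolean atom variable makes `¬b` count as 1). -/
noncomputable def wSumNegV (V : Set (TrVar α)) (S : Finset α) (w : α → ℤ) : ℤ :=
  ∑ b ∈ S.filter (fun b => TrVar.atom b ∉ V), w b

/-- Sum for external support: `Σ_{b∈B⁺(r)\SCC_P(a)} b·w_b^r + Σ_{b∈B⁻(r)} (¬b)·w_b^r`. -/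
noncomputable def extSum (P : Program α) (V : Set (TrVar α)) (r : Rule α) (a : α) : ℤ :=
  wSumPosV V (r.bodyPos.filter (fun b => b ∉ scc P a)) r.wPos +
  wSumNegV V r.bodyNeg r.wNeg

/-- Sum for internal support, using the `dep_{a,b}` variables on `B⁺(r) ∩ SCC_P(a)`. -/
noncomputable def intSum (P : Program α) (V : Set (TrVar α)) (r : Rule α) (a : α) : ℤ :=
  wSumPosV V (r.bodyPos.filter (fun b => b ∉ scc P a)) r.wPos +
  (∑ b ∈ (r.bodyPos.filter (fun b => b ∈ scc P a)).filter
        (fun b => TrVar.dep a b ∈ V), r.wPos b) +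
  wSumNegV V r.bodyNeg r.wNeg

/-- Sum for the gap constraint, using the `gap_{a,b}` variables on `B⁺(r) ∩ SCC_P(a)`. -/
noncomputable def gapSum (P : Program α) (V : Set (TrVar α)) (r : Rule α) (a : α) : ℤ :=
  wSumPosV V (r.bodyPos.filter (fun b => b ∉ scc P a)) r.wPos +
  (∑ b ∈ (r.bodyPos.filter (fun b => b ∈ scc P a)).filter
        (fun b => TrVar.gap a b ∈ V), r.wPos b) +
  wSumNegV V r.bodyNeg r.wNeg

/-- Domain constraints of the integer variables `ℓ_a ∈ [1, s_a]`
(introduced for atoms `a` with `|SCC_P(a)| > 1`). -/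
def levDomOK (P : Program α) (δ : α → ℤ) : Prop :=
  ∀ a ∈ P.atoms, 1 < (scc P a).card → 1 ≤ δ a ∧ δ a ≤ sVal P a

/-- Satisfaction of the ranking constraints `TrRk(P)`. -/
def TrRkSat (P : Program α) (V : Set (TrVar α)) (δ : α → ℤ) : Prop :=
  ∀ a ∈ P.atoms, 1 < (scc P a).card →
    ((δ a ≤ ((scc P a).card : ℤ) ↔ TrVar.atom a ∈ V) ∧
     ∀ b ∈ scc P a, edge P a b →
       ((1 ≤ δ a - δ b ↔ TrVar.dep a b ∈ V) ∧
        (2 ≤ δ a - δ b ↔ TrVar.yv a b ∈ V) ∧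
        ((TrVar.atom a ∈ V ∧ TrVar.atom b ∈ V ∧ TrVar.yv a b ∈ V) ↔ TrVar.gap a b ∈ V)))

/-- Satisfaction of the body translation `TrBd(r)` for the rule with index `i`. -/
def TrBdSat (P : Program α) (V : Set (TrVar α)) (δ : α → ℤ) (i : ℕ) (r : Rule α) : Prop :=
  if r.isConstraintRule then
    (if r.isWeighted then
       wSumPosV V r.bodyPos r.wPos + wSumNegV V r.bodyNeg r.wNeg ≤ r.lb - 1
     else (∃ b ∈ r.bodyPos, TrVar.atom b ∉ V) ∨ (∃ b ∈ r.bodyNeg, TrVar.atom b ∈ V))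
  else
    ((tightHeads P r ≠ ∅ →
      ((if r.isWeighted then
          (r.lb ≤ wSumPosV V r.bodyPos r.wPos + wSumNegV V r.bodyNeg r.wNeg
             ↔ TrVar.bd i ∈ V)
        else
          (((∀ b ∈ r.bodyPos, TrVar.atom b ∈ V) ∧ (∀ b ∈ r.bodyNeg, TrVar.atom b ∉ V))
             ↔ TrVar.bd i ∈ V)) ∧
       ∀ a ∈ tightHeads P r, 1 < (scc P a).card →
         sVal P a * b01 (TrVar.bd i ∈ V) + sVal P a * b01 (TrVar.atom a ∈ V) + δ a
           ≤ 2 * sVal P a + 1)) ∧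
     (∀ a ∈ r.headAtoms, a ∉ tightHeads P r →
       if r.isWeighted then
         (r.lb ≤ extSum P V r a ↔ TrVar.ext i a ∈ V) ∧
         (r.lb ≤ intSum P V r a ↔ TrVar.intv i a ∈ V) ∧
         (gapSum P V r a ≤ r.lb - 1 ↔ TrVar.auxv i a ∈ V) ∧
         (TrVar.ext i a ∈ V ∨ TrVar.auxv i a ∈ V ∨ TrVar.intv i a ∉ V) ∧
         (sVal P a * b01 (TrVar.ext i a ∈ V) + sVal P a * b01 (TrVar.atom a ∈ V) + δ a
            ≤ 2 * sVal P a + 1) ∧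
         ((TrVar.ext i a ∈ V ∨ TrVar.intv i a ∈ V) ↔ TrVar.bda i a ∈ V)
       else
         (((∀ b ∈ r.bodyPos, b ∉ scc P a → TrVar.atom b ∈ V) ∧
           (∀ b ∈ r.bodyPos, b ∈ scc P a → TrVar.dep a b ∈ V) ∧
           (∀ b ∈ r.bodyNeg, TrVar.atom b ∉ V)) ↔ TrVar.bda i a ∈ V) ∧
         (TrVar.bda i a ∉ V ∨ ∃ b ∈ r.bodyPos, b ∈ scc P a ∧ TrVar.gap a b ∉ V)))

/-- Satisfaction of the head translation `TrHd(r)` for the rule with index `i`. -/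
def TrHdSat (P : Program α) (V : Set (TrVar α)) (i : ℕ) (r : Rule α) : Prop :=
  if r.isChoice = false ∧ 1 < r.headAtoms.card then
    (∀ a ∈ r.headAtoms,
       ((TrVar.bd i ∈ V ∧ ∀ a' ∈ r.headAtoms, a' ≠ a → TrVar.atom a' ∉ V)
          ↔ TrVar.sp i a ∈ V)) ∧
    ((∃ a ∈ r.headAtoms, TrVar.atom a ∈ V) ∨ TrVar.bd i ∉ V)
  else
    ∀ a ∈ r.headAtoms,
      ((if ∀ b ∈ r.bodyPos, b ∉ scc P a then (TrVar.sp i a ∈ V ↔ TrVar.bd i ∈ V)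
        else (TrVar.sp i a ∈ V ↔ TrVar.bda i a ∈ V)) ∧
       (r.isChoice = false → TrVar.sp i a ∈ V → TrVar.atom a ∈ V))

/-- Satisfaction of `TrRule(r) = TrBd(r) ∪ TrHd(r)`. -/
def TrRuleSat (P : Program α) (V : Set (TrVar α)) (δ : α → ℤ) (i : ℕ) (r : Rule α) : Prop :=
  TrBdSat P V δ i r ∧ TrHdSat P V i r

/-- Satisfaction of the supportedness constraints `TrSupp(P)`. -/
def TrSuppSat (P : Program α) (V : Set (TrVar α)) : Prop :=
  ∀ a ∈ P.atoms,
    (∃ i, ∃ h : i < P.rules.length,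
        a ∈ (P.rules.get ⟨i, h⟩).headAtoms ∧ TrVar.sp i a ∈ V)
    ∨ TrVar.atom a ∉ V

/-- `⟨V, δ⟩` is a model of the complete translation `Tr(P)`. -/
def TrSat (P : Program α) (V : Set (TrVar α)) (δ : α → ℤ) : Prop :=
  levDomOK P δ ∧ TrRkSat P V δ ∧
  (∀ i, ∀ h : i < P.rules.length, TrRuleSat P V δ i (P.rules.get ⟨i, h⟩)) ∧
  TrSuppSat P V

/-- `I ∩ A_P`: the interpretation of `P` induced by the atom variables true in `V`. -/
noncomputable def atomInterp (P : Program α) (V : Set (TrVar α)) : Finset α :=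
  P.atoms.filter (fun a => TrVar.atom a ∈ V)

/-- The Boolean variables actually occurring in the constraints of `Tr(P)`. -/
def VarsOf (P : Program α) : Set (TrVar α) := fun v =>
  match v with
  | .atom a => a ∈ P.atoms
  | .dep a b => edge P a b ∧ b ∈ scc P a
  | .yv a b => edge P a b ∧ b ∈ scc P a
  | .gap a b => edge P a b ∧ b ∈ scc P a
  | .bd i => ∃ h : i < P.rules.length,
      ¬ (P.rules.get ⟨i, h⟩).isConstraintRule ∧
      (tightHeads P (P.rules.get ⟨i, h⟩) ≠ ∅ ∨
        ((P.rules.get ⟨i, h⟩).isChoice = false ∧ 1 < (P.rules.get ⟨i, h⟩).headAtoms.card))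
  | .bda i a => ∃ h : i < P.rules.length,
      a ∈ (P.rules.get ⟨i, h⟩).headAtoms ∧ a ∉ tightHeads P (P.rules.get ⟨i, h⟩)
  | .sp i a => ∃ h : i < P.rules.length, a ∈ (P.rules.get ⟨i, h⟩).headAtoms
  | .ext i a => ∃ h : i < P.rules.length,
      (P.rules.get ⟨i, h⟩).isWeighted = true ∧
      a ∈ (P.rules.get ⟨i, h⟩).headAtoms ∧ a ∉ tightHeads P (P.rules.get ⟨i, h⟩)
  | .intv i a => ∃ h : i < P.rules.length,
      (P.rules.get ⟨i, h⟩).isWeighted = true ∧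
      a ∈ (P.rules.get ⟨i, h⟩).headAtoms ∧ a ∉ tightHeads P (P.rules.get ⟨i, h⟩)
  | .auxv i a => ∃ h : i < P.rules.length,
      (P.rules.get ⟨i, h⟩).isWeighted = true ∧
      a ∈ (P.rules.get ⟨i, h⟩).headAtoms ∧ a ∉ tightHeads P (P.rules.get ⟨i, h⟩)

/-- The ranked assignment `δ′` induced by a model of `Tr(P)`:
`δ′(ℓ_a) = δ(ℓ_a)` for `a ∈ I` with `|SCC_P(a)| > 1`, `δ′(ℓ_a) = 1` for `a ∈ I`
with `|SCC_P(a)| = 1`, and `δ′(ℓ_a) = ∞` for atoms not in `I`. -/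
noncomputable def liftRank (P : Program α) (V : Set (TrVar α)) (δ : α → ℤ) :
    α → WithTop ℤ :=
  fun b =>
    if b ∈ atomInterp P V then
      (if 1 < (scc P b).card then ((δ b : ℤ) : WithTop ℤ) else 1)
    else ⊤


theorem mem_interp (P : Program α) (V : Set (TrVar α)) {b : α} (hb : b ∈ P.atoms) :
    b ∈ atomInterp P V ↔ TrVar.atom b ∈ V := by
  simp [atomInterp, hb]

theorem weightedVal_eq (P : Program α) (V : Set (TrVar α)) (r : Rule α)
    (h1 : r.bodyPos ⊆ P.atoms) (h2 : r.bodyNeg ⊆ P.atoms) :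
    weightedVal (atomInterp P V) r =
      wSumPosV V r.bodyPos r.wPos + wSumNegV V r.bodyNeg r.wNeg := by
  unfold weightedVal wSumPosV wSumNegV
  congr 1
  · apply Finset.sum_congr _ (fun _ _ => rfl)
    ext b
    simp only [Finset.mem_filter]
    exact and_congr_right fun hb => mem_interp P V (h1 hb)
  · apply Finset.sum_congr _ (fun _ _ => rfl)
    ext b
    simp only [Finset.mem_filter]
    exact and_congr_right fun hb => not_congr (mem_interp P V (h2 hb))

/-- Body satisfaction in terms of the translation variables. -/
def bodyV (V : Set (TrVar α)) (r : Rule α) : Prop :=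
  if r.isWeighted then
    r.lb ≤ wSumPosV V r.bodyPos r.wPos + wSumNegV V r.bodyNeg r.wNeg
  else (∀ b ∈ r.bodyPos, TrVar.atom b ∈ V) ∧ (∀ b ∈ r.bodyNeg, TrVar.atom b ∉ V)

theorem bodySat_iff (P : Program α) (V : Set (TrVar α)) (r : Rule α)
    (h1 : r.bodyPos ⊆ P.atoms) (h2 : r.bodyNeg ⊆ P.atoms) :
    bodySat (atomInterp P V) r ↔ bodyV V r := by
  unfold bodySat bodyV
  rw [weightedVal_eq P V r h1 h2]
  split_ifs
  · rfl
  · unfold normalBodySat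
    exact and_congr
      (forall₂_congr fun b hb => mem_interp P V (h1 hb))
      (forall₂_congr fun b hb => not_congr (mem_interp P V (h2 hb)))

theorem mem_scc (P : Program α) (a b : α) :
    b ∈ scc P a ↔ b ∈ P.atoms ∧ sameSCC P a b := by
  simp [scc]

theorem scc_eq (P : Program α) {a b : α} (h : b ∈ scc P a) : scc P b = scc P a := by
  have h := ((mem_scc P a b).1 h).2
  ext c
  rw [mem_scc, mem_scc]
  exact and_congr_right fun _ =>
    ⟨fun hc => ⟨h.1.trans hc.1, hc.2.trans h.2⟩, fun hc => ⟨h.2.trans hc.1, hc.2.trans h.1⟩⟩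

/-- At most one head atom of a rule of an HCF program is not tight. -/
theorem nontight_unique (P : Program α) (hHCF : isHCF P) {r : Rule α} (hr : r ∈ P.rules)
    {a a' b b' : α} (ha : a ∈ r.headAtoms) (ha' : a' ∈ r.headAtoms)
    (hb : b ∈ r.bodyPos) (hb' : b' ∈ r.bodyPos) (hab : b ∈ scc P a) (hab' : b' ∈ scc P a') :
    a = a' := by
  by_contra hne
  apply hHCF r hr a ha a' ha' hne
  rw [mem_scc]
  have e1 : edge P a b' := ⟨r, hr, ha, hb'⟩
  have e2 : edge P a' b := ⟨r, hr, ha', hb⟩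
  have s := ((mem_scc P a b).1 hab).2
  have s' := ((mem_scc P a' b').1 hab').2
  exact ⟨(P.wf r hr).1 ha', (Relation.ReflTransGen.single e1).trans s'.2,
    (Relation.ReflTransGen.single e2).trans s.2⟩

/-- For a false atom `a`, `dep a b` coincides with `b` inside the component of `a`. -/
theorem dep_iff (P : Program α) (hNT : noSelfLoops P) (V : Set (TrVar α)) (δ : α → ℤ)
    (hM : TrSat P V δ) {a b : α} (haP : a ∈ P.atoms) (hab : b ∈ scc P a) (he : edge P a b)
    (haV : TrVar.atom a ∉ V) : TrVar.dep a b ∈ V ↔ TrVar.atom b ∈ V := by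
  obtain ⟨hdom, hrk, -, -⟩ := hM
  have hbP : b ∈ P.atoms := ((mem_scc P a b).1 hab).1
  have hne : a ≠ b := fun h => hNT a (by rw [← h] at he; exact he)
  have haa : a ∈ scc P a := (mem_scc P a a).2 ⟨haP, .refl, .refl⟩
  have hc : 1 < (scc P a).card := Finset.one_lt_card.2 ⟨a, haa, b, hab, hne⟩
  have hs := scc_eq P hab
  have ra := hrk a haP hc
  have rb := (hrk b hbP (by rw [hs]; exact hc)).1
  have da := hdom a haP hc
  have hd := (ra.2 b hab he).1
  have h1 : ¬ δ a ≤ ((scc P a).card : ℤ) := fun h => haV (ra.1.1 h)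
  unfold sVal at da
  rw [hs] at rb
  rw [← hd, ← rb]
  omega

theorem intSum_eq (P : Program α) (V : Set (TrVar α)) (r : Rule α) (a : α)
    (h : ∀ b ∈ r.bodyPos, b ∈ scc P a → (TrVar.dep a b ∈ V ↔ TrVar.atom b ∈ V)) :
    intSum P V r a = wSumPosV V r.bodyPos r.wPos + wSumNegV V r.bodyNeg r.wNeg := by
  unfold intSum wSumPosV
  congr 1
  rw [← Finset.sum_filter_add_sum_filter_not (r.bodyPos.filter (fun b => TrVar.atom b ∈ V))
    (fun b => b ∈ scc P a), add_comm]
  congr 1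
  · apply Finset.sum_congr _ (fun _ _ => rfl)
    ext b
    simp only [Finset.mem_filter]
    constructor
    · rintro ⟨⟨h1, h2⟩, h3⟩
      exact ⟨⟨h1, (h b h1 h2).1 h3⟩, h2⟩
    · rintro ⟨⟨h1, h2⟩, h3⟩
      exact ⟨⟨h1, h3⟩, (h b h1 h3).2 h2⟩
  · apply Finset.sum_congr _ (fun _ _ => rfl)
    ext b
    simp only [Finset.mem_filter]
    tauto

theorem tight_bd (P : Program α) (V : Set (TrVar α)) (δ : α → ℤ) (i : ℕ) (r : Rule α)
    (hc : ¬ r.isConstraintRule) (h : TrBdSat P V δ i r) (hT : tightHeads P r ≠ ∅)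
    (hB : bodyV V r) : TrVar.bd i ∈ V := by
  unfold TrBdSat at h
  rw [if_neg hc] at h
  have h := (h.1 hT).1
  unfold bodyV at hB
  split_ifs at h hB
  · exact h.1 hB
  · exact h.1 hB

/-- Let `P` be a partially shifted HCF program and `⟨I, δ⟩` a model
of `Tr(P)`.  Then `I ∩ A_P ⊨ P`. -/
theorem statement9 (P : Program α) (hps : isPartiallyShifted P) (hHCF : isHCF P)
    (hNT : noSelfLoops P)
    (V : Set (TrVar α)) (δ : α → ℤ) (hM : TrSat P V δ) :
    progSat (atomInterp P V) P := by
  intro r hr hbody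
  obtain ⟨wf1, wf2, wf3⟩ := P.wf r hr
  rw [bodySat_iff P V r wf2 wf3] at hbody
  obtain ⟨i, hi, hri⟩ := List.getElem_of_mem hr
  have hR : TrRuleSat P V δ i r := by
    have := hM.2.2.1 i hi
    rw [← hri]; exact this
  obtain ⟨hBd, hHd⟩ := hR
  by_cases hch : r.isChoice = true
  · exact Or.inl hch
  have hch : r.isChoice = false := by simpa using hch
  right
  suffices hex : ∃ a ∈ r.headAtoms, TrVar.atom a ∈ V by
    obtain ⟨a, ha, haV⟩ := hex
    exact ⟨a, ha, (mem_interp P V (wf1 ha)).2 haV⟩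
  by_cases hc : r.isConstraintRule
  · exfalso
    unfold TrBdSat at hBd
    rw [if_pos hc] at hBd
    unfold bodyV at hbody
    split_ifs at hBd hbody
    · omega
    · rcases hBd with ⟨b, hb, hbV⟩ | ⟨b, hb, hbV⟩
      · exact hbV (hbody.1 b hb)
      · exact hbody.2 b hb hbV
  have hmemT : ∀ a, a ∈ tightHeads P r ↔ a ∈ r.headAtoms ∧ ∀ b ∈ r.bodyPos, b ∉ scc P a := by
    intro a; simp [tightHeads]
  unfold TrHdSat at hHd
  by_cases hcard : 1 < r.headAtoms.card
  · rw [if_pos ⟨hch, hcard⟩] at hHd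
    have hT : tightHeads P r ≠ ∅ := by
      intro hT
      obtain ⟨a, ha, a', ha', hne⟩ := Finset.one_lt_card.1 hcard
      have key : ∀ x ∈ r.headAtoms, ∃ b ∈ r.bodyPos, b ∈ scc P x := by
        intro x hx
        by_contra hcon
        push Not at hcon
        have := (hmemT x).2 ⟨hx, hcon⟩
        rw [hT] at this
        simp at this
      obtain ⟨b, hb, hab⟩ := key a ha
      obtain ⟨b', hb', hab'⟩ := key a' ha'
      exact hne (nontight_unique P hHCF hr ha ha' hb hb' hab hab')
    exact hHd.2.resolve_right (fun h => h (tight_bd P V δ i r hc hBd hT hbody))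
  · rw [if_neg (fun h => hcard h.2)] at hHd
    have hne : r.headAtoms.Nonempty :=
      Finset.nonempty_iff_ne_empty.2 fun h => hc ⟨hch, h⟩
    obtain ⟨a, ha⟩ := hne
    refine ⟨a, ha, ?_⟩
    obtain ⟨h1, h2⟩ := hHd a ha
    by_cases ht : ∀ b ∈ r.bodyPos, b ∉ scc P a
    · rw [if_pos ht] at h1
      have hT : tightHeads P r ≠ ∅ := Finset.ne_empty_of_mem ((hmemT a).2 ⟨ha, ht⟩)
      exact h2 hch (h1.2 (tight_bd P V δ i r hc hBd hT hbody))
    · rw [if_neg ht] at h1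
      by_contra haV
      apply haV
      apply h2 hch
      apply h1.2
      have hdep : ∀ b ∈ r.bodyPos, b ∈ scc P a → (TrVar.dep a b ∈ V ↔ TrVar.atom b ∈ V) :=
        fun b hb hab => dep_iff P hNT V δ hM (wf1 ha) hab ⟨r, hr, ha, hb⟩ haV
      unfold TrBdSat at hBd
      rw [if_neg hc] at hBd
      have hB := hBd.2 a ha (fun h => ht ((hmemT a).1 h).2)
      unfold bodyV at hbody
      split_ifs at hB hbody
      · obtain ⟨-, hint, -, -, -, hbda⟩ := hB
        rw [intSum_eq P V r a hdep] at hint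
        exact hbda.1 (Or.inr (hint.1 hbody))
      · exact hB.1.1 ⟨fun b hb _ => hbody.1 b hb,
          fun b hb hab => (hdep b hb hab).2 (hbody.1 b hb), hbody.2⟩

end AspFzn
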